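/- Let G be a group and let 𝓕 be a nonempty set of subgroups of G that is closed under pairwise intersections and has the property that any finitely many subgroups H₁,…,Hₙ ∈ 𝓕 admit a common complement in 𝓕, i.e. a proper subgroup K ∈ 𝓕 with (H₁ ∩ ⋯ ∩ Hₙ)K = G. Then the geometric realization of the nerve of the poset of all cosets gH with g ∈ G and H ∈ 𝓕, ordered by inclusion, is contractible. -/

import Mathlib

open scoped Pointwise

/-- The coset poset associated with a family `F` of subgroups of `G`: the set of
all cosets `g • H` with `g ∈ G` and `H ∈ F`, partially ordered by inclusion. -/
def CosetPoset (G : Type) [Group G] (F : Set (Subgroup G)) : Type _ :=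
  {X : Set G // ∃ H ∈ F, ∃ g : G, X = g • (H : Set G)}

instance {G : Type} [Group G] {F : Set (Subgroup G)} : PartialOrder (CosetPoset G F) :=
  Subtype.partialOrder _

/-- The geometric realization of the nerve of the coset poset of the family `F`. -/
noncomputable def cosetNerveRealization (G : Type) [Group G] (F : Set (Subgroup G)) : TopCat :=
  SSet.toTop.obj (CategoryTheory.nerve (CosetPoset G F))

namespace CosetNerve

open scoped NNReal

section Realization

open CategoryTheory Simplicial Opposite

variable {X : SSet.{0}}

/-- The characteristic map of a simplex in the geometric realization. -/
noncomputable def charMap {n : ℕ} (x : X _⦋n⦌) :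
    C(stdSimplex ℝ (Fin (n + 1)), SSet.toTop.obj X) :=
  (SSet.toTop.map (SSet.yonedaEquiv.symm x)).hom.comp
    ⟨_, (SimplexCategory.toTopHomeo ⦋n⦌).symm.continuous⟩

lemma charMap_map {m n : ℕ} (f : (⦋m⦌ : SimplexCategory) ⟶ ⦋n⦌) (x : X _⦋n⦌)
    (t : stdSimplex ℝ (Fin (m + 1))) :
    charMap (X.map f.op x) t = charMap x (stdSimplex.map f t) := by
  have h := SimplexCategory.toTopHomeo_symm_naturality_apply.{0} f t
  have h2 : SSet.yonedaEquiv.symm (X.map f.op x) =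
      SSet.stdSimplex.map f ≫ SSet.yonedaEquiv.symm x := by
    apply SSet.yonedaEquiv.injective
    simp only [Equiv.apply_symm_apply, SSet.yonedaEquiv_comp, SSet.yonedaEquiv_map]
    rfl
  simp only [charMap, h2, Functor.map_comp]
  exact congrArg (SSet.toTop.map (SSet.yonedaEquiv.symm x)).hom h.symm

lemma unit_app_eq_charMap {n : ℕ} (x : X _⦋n⦌) :
    TopCat.toSSetObjEquiv _ _ ((sSetTopAdj.unit.app X).app _ x) = charMap x := by
  ext t
  exact congrArg (fun h ↦ h.hom (ULift.up t))
    (sSetTopAdj_unit_app_app_down X (op ⦋n⦌) x)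

lemma homEquiv_app {Z : TopCat.{0}} (K : SSet.toTop.obj X ⟶ Z) {n : ℕ} (x : X _⦋n⦌) :
    TopCat.toSSetObjEquiv _ _ ((sSetTopAdj.homEquiv X Z K).app _ x) = K.hom.comp (charMap x) := by
  rw [Adjunction.homEquiv_unit, ← unit_app_eq_charMap]
  rfl

lemma toTop_hom_ext {Z : Type} [TopologicalSpace Z] {K K' : C(SSet.toTop.obj X, Z)}
    (h : ∀ (n : ℕ) (x : X _⦋n⦌) (t : stdSimplex ℝ (Fin (n + 1))),
      K (charMap x t) = K' (charMap x t)) : K = K' := by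
  suffices TopCat.ofHom K = TopCat.ofHom K' from congrArg TopCat.Hom.hom this
  apply (sSetTopAdj.homEquiv X (TopCat.of Z)).injective
  ext ⟨n⟩ x
  induction n with | _ n
  apply (TopCat.toSSetObjEquiv (TopCat.of Z) _).injective
  refine (homEquiv_app (TopCat.ofHom K) x).trans
    (Eq.trans ?_ (homEquiv_app (TopCat.ofHom K') x).symm)
  ext t
  exact h n x t

lemma exists_toTop_desc {Z : Type} [TopologicalSpace Z]
    (k : ∀ n, X _⦋n⦌ → C(stdSimplex ℝ (Fin (n + 1)), Z))
    (hk : ∀ (m n : ℕ) (f : (⦋m⦌ : SimplexCategory) ⟶ ⦋n⦌) (x : X _⦋n⦌)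
      (t : stdSimplex ℝ (Fin (m + 1))),
      k m (X.map f.op x) t = k n x (stdSimplex.map f t)) :
    ∃ K : C(SSet.toTop.obj X, Z), ∀ n (x : X _⦋n⦌) (t : stdSimplex ℝ (Fin (n + 1))),
      K (charMap x t) = k n x t := by
  let φ : X ⟶ TopCat.toSSet.obj (TopCat.of Z) :=
    { app n := ↾fun x ↦ (TopCat.toSSetObjEquiv (TopCat.of Z) n).symm (k n.unop.len x)
      naturality := by
        rintro ⟨n⟩ ⟨m⟩ ⟨f⟩
        induction n with | _ n
        induction m with | _ m
        ext x
        apply (TopCat.toSSetObjEquiv _ _).injective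
        ext t
        exact hk m n f x t }
  refine ⟨((sSetTopAdj.homEquiv X (TopCat.of Z)).symm φ).hom, fun n x t ↦ ?_⟩
  have h := homEquiv_app ((sSetTopAdj.homEquiv X (TopCat.of Z)).symm φ) x
  rw [Equiv.apply_symm_apply] at h
  exact (DFunLike.congr_fun h t).symm

end Realization

section Normalize

lemma le_mapDomain_apply {ι κ : Type*} (g : ι → κ) (v : ι →₀ ℝ≥0) (i : ι) :
    v i ≤ Finsupp.mapDomain g v (g i) := by
  classical
  by_cases h : i ∈ v.support
  · rw [Finsupp.mapDomain, Finsupp.sum, Finsupp.finsetSum_apply]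
    refine le_trans ?_ (Finset.single_le_sum (fun _ _ ↦ zero_le) h)
    simp
  · simp [Finsupp.notMem_support_iff.1 h]

lemma mapDomain_ne_zero {ι κ : Type*} (g : ι → κ) {v : ι →₀ ℝ≥0} (h : v ≠ 0) :
    Finsupp.mapDomain g v ≠ 0 := by
  obtain ⟨i, hi⟩ := DFunLike.ne_iff.1 h
  exact DFunLike.ne_iff.2 ⟨g i, ((pos_iff_ne_zero.2 hi).trans_le (le_mapDomain_apply g v i)).ne'⟩

lemma support_mapDomain_eq {ι κ : Type*} [DecidableEq κ] (g : ι → κ) (v : ι →₀ ℝ≥0) :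
    (Finsupp.mapDomain g v).support = v.support.image g := by
  refine Finsupp.mapDomain_support.antisymm fun k hk ↦ ?_
  obtain ⟨i, hi, rfl⟩ := Finset.mem_image.1 hk
  rw [Finsupp.mem_support_iff] at hi ⊢
  exact ((pos_iff_ne_zero.2 hi).trans_le (le_mapDomain_apply g v i)).ne'

lemma mapDomain_apply_eq_sum {ι κ : Type*} [Fintype ι] [DecidableEq κ] (g : ι → κ)
    (v : ι →₀ ℝ≥0) (k : κ) : Finsupp.mapDomain g v k = ∑ i with g i = k, v i := by
  rw [Finsupp.mapDomain, Finsupp.sum_fintype _ _ (by simp), Finsupp.finsetSum_apply,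
    Finset.sum_filter]
  simp [Finsupp.single_apply]

variable {ι κ : Type*} [Fintype ι] [Fintype κ]

lemma sum_ne_zero {v : ι →₀ ℝ≥0} (h : v ≠ 0) : ∑ i, v i ≠ 0 := fun h' ↦
  h (Finsupp.ext fun i ↦ Finset.sum_eq_zero_iff.1 h' i (Finset.mem_univ i))

/-- The barycentric coordinates of a point of the standard simplex. -/
noncomputable def coords (t : stdSimplex ℝ ι) : ι →₀ ℝ≥0 :=
  Finsupp.equivFunOnFinite.symm fun i ↦ ⟨t i, stdSimplex.zero_le t i⟩

@[simp] lemma coe_coords (t : stdSimplex ℝ ι) (i : ι) : (coords t i : ℝ) = t i := rfl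

lemma continuous_coords (i : ι) : Continuous fun t : stdSimplex ℝ ι ↦ coords t i :=
  Continuous.subtype_mk ((continuous_apply i).comp continuous_subtype_val) _

lemma coords_ne_zero (t : stdSimplex ℝ ι) : coords t ≠ 0 := by
  intro h
  have := stdSimplex.sum_eq_one t
  simp [← coe_coords, h] at this

lemma coords_map (g : ι → κ) (t : stdSimplex ℝ ι) :
    coords (stdSimplex.map g t) = Finsupp.mapDomain g (coords t) := by
  classical
  ext k
  rw [coe_coords, stdSimplex.map_coe, FunOnFinite.linearMap_apply_apply, mapDomain_apply_eq_sum]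
  simp

variable [Nonempty ι] [Nonempty κ]

/-- The point of the standard simplex obtained by normalizing nonzero weights. -/
noncomputable def normalize (v : ι →₀ ℝ≥0) : stdSimplex ℝ ι :=
  if h : v = 0 then Classical.arbitrary _ else
    ⟨fun i ↦ ((v i / ∑ j, v j : ℝ≥0) : ℝ), fun i ↦ NNReal.coe_nonneg _, by
      rw [← NNReal.coe_sum, ← Finset.sum_div, div_self (sum_ne_zero h), NNReal.coe_one]⟩

lemma normalize_apply {v : ι →₀ ℝ≥0} (h : v ≠ 0) (i : ι) :
    normalize v i = ((v i / ∑ j, v j : ℝ≥0) : ℝ) := by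
  rw [normalize, dif_neg h]
  rfl

lemma map_normalize (g : ι → κ) {v : ι →₀ ℝ≥0} (h : v ≠ 0) :
    stdSimplex.map g (normalize v) = normalize (Finsupp.mapDomain g v) := by
  classical
  ext k
  rw [normalize_apply (mapDomain_ne_zero g h), stdSimplex.map_coe,
    FunOnFinite.linearMap_apply_apply]
  simp only [normalize_apply h, mapDomain_apply_eq_sum g v]
  rw [Finset.sum_fiberwise Finset.univ g v, ← NNReal.coe_sum, Finset.sum_div]

lemma normalize_coords (t : stdSimplex ℝ ι) : normalize (coords t) = t := by
  ext i
  have := stdSimplex.sum_eq_one t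
  simp [normalize_apply (coords_ne_zero t), this]

lemma continuous_normalize {Y : Type*} [TopologicalSpace Y] {v : Y → ι →₀ ℝ≥0}
    (hv : ∀ i, Continuous fun y ↦ v y i) (h : ∀ y, v y ≠ 0) :
    Continuous fun y ↦ normalize (v y) := by
  refine continuous_induced_rng.2 (continuous_pi fun i ↦ ?_)
  have : Continuous fun y ↦ ((v y i / ∑ j, v y j : ℝ≥0) : ℝ) :=
    NNReal.continuous_coe.comp
      ((hv i).div (continuous_finsetSum _ fun j _ ↦ hv j) fun y ↦ sum_ne_zero (h y))
  exact this.congr fun y ↦ (normalize_apply (h y) i).symm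

end Normalize

section Nerve

open CategoryTheory Simplicial Opposite

variable {P : Type} [PartialOrder P]

/-- The characteristic map of the simplex of the nerve given by a monotone sequence. -/
noncomputable def seqMap {n : ℕ} (x : Fin (n + 1) →o P) :
    C(stdSimplex ℝ (Fin (n + 1)), SSet.toTop.obj (nerve P)) :=
  charMap (X := nerve P) (n := n) x.monotone.functor

lemma seqMap_comp {m n : ℕ} (x : Fin (n + 1) →o P) (g : Fin (m + 1) →o Fin (n + 1))
    (t : stdSimplex ℝ (Fin (m + 1))) :
    seqMap (x.comp g) t = seqMap x (stdSimplex.map g t) :=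
  charMap_map (X := nerve P) (SimplexCategory.mkHom g) x.monotone.functor t

lemma nerve_hom_ext {Z : Type} [TopologicalSpace Z] {K K' : C(SSet.toTop.obj (nerve P), Z)}
    (h : ∀ (n : ℕ) (x : Fin (n + 1) →o P) (t : stdSimplex ℝ (Fin (n + 1))),
      K (seqMap x t) = K' (seqMap x t)) : K = K' :=
  toTop_hom_ext fun n x t ↦ h n ⟨x.obj, x.monotone⟩ t

lemma exists_nerve_desc {Z : Type} [TopologicalSpace Z]
    (k : ∀ n, (Fin (n + 1) →o P) → C(stdSimplex ℝ (Fin (n + 1)), Z))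
    (hk : ∀ (m n : ℕ) (g : Fin (m + 1) →o Fin (n + 1)) (x : Fin (n + 1) →o P)
      (t : stdSimplex ℝ (Fin (m + 1))),
      k m (x.comp g) t = k n x (stdSimplex.map g t)) :
    ∃ K : C(SSet.toTop.obj (nerve P), Z), ∀ n (x : Fin (n + 1) →o P)
      (t : stdSimplex ℝ (Fin (n + 1))), K (seqMap x t) = k n x t := by
  obtain ⟨K, hK⟩ := exists_toTop_desc (X := nerve P) (fun n x ↦ k n ⟨x.obj, x.monotone⟩)
    fun m n f x t ↦ hk m n f.toOrderHom ⟨x.obj, x.monotone⟩ t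
  exact ⟨K, fun n x t ↦ hK n x.monotone.functor t⟩

lemma seqMap_normalize_eq {m n : ℕ} {x : Fin (n + 1) →o P} {v : Fin (n + 1) →₀ ℝ≥0}
    {y : Fin (m + 1) →o P} {v' : Fin (m + 1) →₀ ℝ≥0} (hy : StrictMono y) (hv : v ≠ 0)
    (h : Finsupp.mapDomain x v = Finsupp.mapDomain y v') :
    seqMap x (normalize v) = seqMap y (normalize v') := by
  obtain ⟨k, hk⟩ : ∃ k, v.support.card = k + 1 :=
    Nat.exists_eq_succ_of_ne_zero (by simpa using hv)
  let α : Fin (k + 1) ↪o Fin (n + 1) := v.support.orderEmbOfFin hk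
  have hα : Set.range α = v.support := Finset.range_orderEmbOfFin _ hk
  let u := Finsupp.comapDomain α v α.injective.injOn
  have hu : Finsupp.mapDomain α u = v :=
    Finsupp.mapDomain_comapDomain α α.injective v hα.ge
  have hu0 : u ≠ 0 := by
    intro h0
    rw [h0, Finsupp.mapDomain_zero] at hu
    exact hv hu.symm
  have hx : ∀ i, ∃ j, y j = x (α i) := by
    intro i
    have hi : v (α i) ≠ 0 := Finsupp.mem_support_iff.1 (Finset.mem_coe.1 (hα ▸ ⟨i, rfl⟩))
    have h1 := ((pos_iff_ne_zero.2 hi).trans_le (le_mapDomain_apply x v (α i))).ne'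
    rw [h] at h1
    exact Finsupp.mem_range_of_mapDomain_ne_zero h1
  choose g hg using hx
  let g' : Fin (k + 1) →o Fin (m + 1) :=
    ⟨g, fun i j hij ↦ by
      rw [← hy.le_iff_le, hg, hg]
      exact x.monotone (α.monotone hij)⟩
  have hxg : x.comp α.toOrderHom = y.comp g' := OrderHom.ext _ _ (funext fun i ↦ (hg i).symm)
  have hv' : Finsupp.mapDomain g' u = v' := by
    apply Finsupp.mapDomain_injective hy.injective
    rw [← h, ← hu, ← Finsupp.mapDomain_comp, ← Finsupp.mapDomain_comp]
    exact congrArg (fun f : Fin (k + 1) →o P ↦ Finsupp.mapDomain f u) hxg.symm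
  rw [← hv', ← map_normalize _ hu0, ← seqMap_comp, ← hxg, seqMap_comp]
  conv_lhs => rw [← hu, ← map_normalize _ hu0]
  rfl

lemma exists_strictMono_range_eq {c : Finset P} (hc : c.Nonempty)
    (hc' : IsChain (· ≤ ·) (c : Set P)) :
    ∃ (n : ℕ) (y : Fin (n + 1) →o P), StrictMono y ∧ Set.range y = c := by
  classical
  let _ : LinearOrder (c : Set P) := hc'.linearOrder
  obtain ⟨n, hn⟩ : ∃ n, (Finset.univ : Finset (c : Set P)).card = n + 1 :=
    Nat.exists_eq_succ_of_ne_zero (by simpa using hc.ne_empty)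
  let e := (Finset.univ : Finset (c : Set P)).orderEmbOfFin hn
  have he : StrictMono fun i ↦ (e i : P) := fun i j hij ↦ e.strictMono hij
  refine ⟨n, ⟨fun i ↦ e i, he.monotone⟩, he, ?_⟩
  have : Set.range e = Set.univ := by
    rw [Finset.range_orderEmbOfFin Finset.univ hn, Finset.coe_univ]
  change Set.range (Subtype.val ∘ e) = _
  rw [Set.range_comp, this]
  simp

/-- Weights are good if they define, up to scaling, a point of the realization of the nerve. -/
def IsGood {Q : Type*} [PartialOrder Q] (w : Q →₀ ℝ≥0) : Prop :=
  w ≠ 0 ∧ IsChain (· ≤ ·) (w.support : Set Q)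

lemma IsGood.exists_eq_mapDomain {w : P →₀ ℝ≥0} (hw : IsGood w) :
    ∃ (n : ℕ) (y : Fin (n + 1) →o P) (v : Fin (n + 1) →₀ ℝ≥0),
      StrictMono y ∧ v ≠ 0 ∧ Finsupp.mapDomain y v = w := by
  obtain ⟨n, y, hy, hyw⟩ := exists_strictMono_range_eq
    (Finsupp.support_nonempty_iff.2 hw.1) hw.2
  have h := Finsupp.mapDomain_comapDomain y hy.injective w hyw.ge
  refine ⟨n, y, _, hy, fun h0 ↦ hw.1 ?_, h⟩
  rw [← h, h0, Finsupp.mapDomain_zero]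

lemma isGood_mapDomain {n : ℕ} {Q : Type*} [PartialOrder Q] (x : Fin (n + 1) →o Q)
    {v : Fin (n + 1) →₀ ℝ≥0} (hv : v ≠ 0) : IsGood (Finsupp.mapDomain x v) := by
  classical
  refine ⟨mapDomain_ne_zero _ hv, ?_⟩
  rw [support_mapDomain_eq]
  intro a ha b hb _
  simp only [Finset.coe_image, Set.mem_image] at ha hb
  obtain ⟨i, -, rfl⟩ := ha
  obtain ⟨j, -, rfl⟩ := hb
  exact (le_total i j).imp (fun h ↦ x.monotone h) (fun h ↦ x.monotone h)

instance [Nonempty P] : Nonempty (SSet.toTop.obj (nerve P)) :=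
  ⟨seqMap (n := 0) (OrderHom.const _ (Classical.arbitrary P)) (Classical.arbitrary _)⟩

variable [Nonempty P]

/-- The point of the realization of the nerve defined by good weights. -/
noncomputable def realize (w : P →₀ ℝ≥0) : SSet.toTop.obj (nerve P) :=
  Classical.epsilon fun p ↦ ∃ (n : ℕ) (y : Fin (n + 1) →o P) (v : Fin (n + 1) →₀ ℝ≥0),
    StrictMono y ∧ Finsupp.mapDomain y v = w ∧ p = seqMap y (normalize v)

lemma realize_mapDomain {n : ℕ} (x : Fin (n + 1) →o P) {v : Fin (n + 1) →₀ ℝ≥0} (hv : v ≠ 0) :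
    realize (Finsupp.mapDomain x v) = seqMap x (normalize v) := by
  obtain ⟨m, y, u, hy, hu, h⟩ := (isGood_mapDomain x hv).exists_eq_mapDomain
  obtain ⟨m', y', u', hy', h', hp⟩ := Classical.epsilon_spec
    (p := fun p ↦ ∃ (n : ℕ) (y : Fin (n + 1) →o P) (u : Fin (n + 1) →₀ ℝ≥0),
      StrictMono y ∧ Finsupp.mapDomain y u = Finsupp.mapDomain x v ∧ p = seqMap y (normalize u))
    ⟨_, m, y, u, hy, h, rfl⟩
  exact hp.trans (seqMap_normalize_eq hy' hv h'.symm).symm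

/-- A family of weights is continuous and supported in a common finite set. -/
def IsNice {Y Q : Type*} [TopologicalSpace Y] (w : Y → Q →₀ ℝ≥0) : Prop :=
  (∃ S : Finset Q, ∀ y, (w y).support ⊆ S) ∧ ∀ q, Continuous fun y ↦ w y q

lemma continuous_realize {Y : Type*} [TopologicalSpace Y] {w : Y → P →₀ ℝ≥0} (hw : IsNice w)
    (hw' : ∀ y, IsGood (w y)) : Continuous fun y ↦ realize (w y) := by
  classical
  obtain ⟨⟨S, hS⟩, hc⟩ := hw
  let J := {c : Finset P // c ∈ S.powerset ∧ c.Nonempty ∧ IsChain (· ≤ ·) (c : Set P)}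
  have : Finite J := Finite.of_injective
    (fun c : J ↦ (⟨c.1, c.2.1⟩ : S.powerset)) fun c c' h ↦
      Subtype.ext (congrArg (fun d : S.powerset ↦ d.1) h)
  let f : J → Set Y := fun c ↦ {y | (w y).support ⊆ c.1}
  refine (locallyFinite_of_finite f).continuous ?_ ?_ ?_
  · refine Set.eq_univ_of_forall fun y ↦ Set.mem_iUnion.2 ⟨⟨(w y).support, ?_, ?_, (hw' y).2⟩, ?_⟩
    · exact Finset.mem_powerset.2 (hS y)
    · exact Finsupp.support_nonempty_iff.2 (hw' y).1
    · exact Finset.Subset.refl _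
  · intro c
    have : f c = ⋂ q ∈ (c.1 : Set P)ᶜ, {y | w y q = 0} := by
      ext y
      simp only [f, Set.mem_ofPred_eq, Set.mem_iInter, Set.mem_compl_iff, Finset.mem_coe,
        Finset.subset_iff, Finsupp.mem_support_iff]
      exact forall_congr' fun q ↦ not_imp_comm
    rw [this]
    exact isClosed_biInter fun q _ ↦ isClosed_eq (hc q) continuous_const
  · rintro ⟨c, -, hcn, hcc⟩
    obtain ⟨n, y, hy, hyc⟩ := exists_strictMono_range_eq hcn hcc
    rw [continuousOn_iff_continuous_domRestrict]
    let u : {a // (w a).support ⊆ c} → Fin (n + 1) →₀ ℝ≥0 := fun a ↦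
      Finsupp.comapDomain y (w a) hy.injective.injOn
    have hu : ∀ a, Finsupp.mapDomain y (u a) = w a := fun a ↦
      Finsupp.mapDomain_comapDomain y hy.injective (w a) (by rw [hyc]; exact_mod_cast a.2)
    have hu0 : ∀ a, u a ≠ 0 := fun a h0 ↦ (hw' a).1 (by rw [← hu, h0, Finsupp.mapDomain_zero])
    have h1 : Continuous fun a ↦ seqMap y (normalize (u a)) :=
      (seqMap y).continuous.comp
        (continuous_normalize (fun i ↦ (hc (y i)).comp continuous_subtype_val) hu0)
    refine h1.congr fun a ↦ ?_
    rw [← realize_mapDomain y (hu0 a), hu]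
    rfl

end Nerve

section Operations

open CategoryTheory

variable {P : Type} [PartialOrder P]

/-- An operation on weights that preserves good weights and nice families. -/
structure IsOp {Q Q' : Type} [PartialOrder Q] [PartialOrder Q']
    (T : (Q →₀ ℝ≥0) → (Q' →₀ ℝ≥0)) : Prop where
  good : ∀ w, IsGood w → IsGood (T w)
  nice : ∀ (Y : Type) [TopologicalSpace Y] (w : Y → Q →₀ ℝ≥0), (∀ y, IsGood (w y)) →
    IsNice w → IsNice fun y ↦ T (w y)

lemma IsOp.comp {Q Q' Q'' : Type} [PartialOrder Q] [PartialOrder Q'] [PartialOrder Q'']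
    {T : (Q →₀ ℝ≥0) → (Q' →₀ ℝ≥0)} {T' : (Q' →₀ ℝ≥0) → (Q'' →₀ ℝ≥0)}
    (hT' : IsOp T') (hT : IsOp T) : IsOp fun w ↦ T' (T w) where
  good _ hw := hT'.good _ (hT.good _ hw)
  nice Y _ w hg hw := hT'.nice Y _ (fun y ↦ hT.good _ (hg y)) (hT.nice Y w hg hw)

lemma IsOp.id {Q : Type} [PartialOrder Q] : IsOp fun w : Q →₀ ℝ≥0 ↦ w where
  good _ hw := hw
  nice _ _ _ _ hw := hw

lemma IsNice.mapDomain {Y Q Q' : Type*} [TopologicalSpace Y] {w : Y → Q →₀ ℝ≥0}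
    (hw : IsNice w) (f : Q → Q') : IsNice fun y ↦ Finsupp.mapDomain f (w y) := by
  classical
  obtain ⟨⟨S, hS⟩, hc⟩ := hw
  refine ⟨⟨S.image f, fun y ↦ ?_⟩, fun q ↦ ?_⟩
  · rw [support_mapDomain_eq]
    exact Finset.image_subset_image (hS y)
  · have : Continuous fun y ↦ ∑ i ∈ S, Finsupp.single (f i) (w y i) q := by
      refine continuous_finsetSum _ fun i _ ↦ ?_
      by_cases h : f i = q
      · simpa [h] using hc i
      · simpa [h] using continuous_const
    refine this.congr fun y ↦ ?_
    have h : Finsupp.mapDomain f (w y) = ∑ i ∈ S, Finsupp.single (f i) (w y i) :=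
      Finsupp.sum_of_support_subset _ (hS y) _ (by simp)
    rw [← Finsupp.finsetSum_apply]
    exact DFunLike.congr_fun h.symm q

lemma isNice_coords {n : ℕ} : IsNice (coords (ι := Fin (n + 1))) :=
  ⟨⟨Finset.univ, fun _ ↦ Finset.subset_univ _⟩, continuous_coords⟩

lemma IsNice.combination {Y Q : Type*} [TopologicalSpace Y] {w w' : Y → Q →₀ ℝ≥0}
    (hw : IsNice w) (hw' : IsNice w') {a a' : Y → ℝ≥0} (ha : Continuous a)
    (ha' : Continuous a') : IsNice fun y ↦ a y • w y + a' y • w' y := by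
  classical
  obtain ⟨⟨S, hS⟩, hc⟩ := hw
  obtain ⟨⟨S', hS'⟩, hc'⟩ := hw'
  refine ⟨⟨S ∪ S', fun y ↦ Finsupp.support_add.trans (Finset.union_subset_union
    (Finsupp.support_smul.trans (hS y)) (Finsupp.support_smul.trans (hS' y)))⟩, fun q ↦ ?_⟩
  exact (ha.mul (hc q)).add (ha'.mul (hc' q))

lemma IsNice.comp {Y Y' Q : Type*} [TopologicalSpace Y] [TopologicalSpace Y']
    {w : Y → Q →₀ ℝ≥0} (hw : IsNice w) {f : Y' → Y} (hf : Continuous f) :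
    IsNice fun y ↦ w (f y) :=
  ⟨⟨hw.1.choose, fun y ↦ hw.1.choose_spec (f y)⟩, fun q ↦ (hw.2 q).comp hf⟩

lemma isGood_combination {Q : Type*} [PartialOrder Q] {w w' : Q →₀ ℝ≥0} (hw : w ≠ 0)
    (hw' : w' ≠ 0) (h : IsChain (· ≤ ·) ((w.support : Set Q) ∪ w'.support)) {a a' : ℝ≥0}
    (ha : a + a' = 1) : IsGood (a • w + a' • w') := by
  classical
  refine ⟨fun h0 ↦ ?_, h.mono ?_⟩
  · rw [add_eq_zero] at h0
    simp only [smul_eq_zero, hw, hw', or_false] at h0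
    simp [h0.1, h0.2] at ha
  · intro q hq
    have h1 : q ∈ (a • w).support ∪ (a' • w').support := Finsupp.support_add hq
    exact (Finset.mem_union.1 h1).imp (fun h ↦ Finsupp.support_smul h)
      (fun h ↦ Finsupp.support_smul h)

variable [Nonempty P]

/-- A self-map of the realization of the nerve is given by an operation on weights. -/
def Realizes (F : C(SSet.toTop.obj (nerve P), SSet.toTop.obj (nerve P)))
    (T : (P →₀ ℝ≥0) → (P →₀ ℝ≥0)) : Prop :=
  ∀ (n : ℕ) (x : Fin (n + 1) →o P) (t : stdSimplex ℝ (Fin (n + 1))),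
    F (seqMap x t) = realize (T (Finsupp.mapDomain x (coords t)))

lemma Realizes.unique {F F' : C(SSet.toTop.obj (nerve P), SSet.toTop.obj (nerve P))}
    {T : (P →₀ ℝ≥0) → (P →₀ ℝ≥0)} (h : Realizes F T) (h' : Realizes F' T) : F = F' :=
  nerve_hom_ext fun n x t ↦ (h n x t).trans (h' n x t).symm

lemma realizes_id : Realizes (P := P) (ContinuousMap.id _) fun w ↦ w := fun n x t ↦ by
  rw [realize_mapDomain x (coords_ne_zero t), normalize_coords]
  rfl

lemma exists_realizes_homotopic {T T' : (P →₀ ℝ≥0) → (P →₀ ℝ≥0)} (hT : IsOp T) (hT' : IsOp T')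
    (h : ∀ w, IsGood w → IsChain (· ≤ ·) (((T w).support : Set P) ∪ (T' w).support)) :
    ∃ F F' : C(SSet.toTop.obj (nerve P), SSet.toTop.obj (nerve P)),
      Realizes F T ∧ Realizes F' T' ∧ F.Homotopic F' := by
  let w (n : ℕ) (x : Fin (n + 1) →o P) (t : stdSimplex ℝ (Fin (n + 1))) : P →₀ ℝ≥0 :=
    Finsupp.mapDomain x (coords t)
  have hw : ∀ n x t, IsGood (w n x t) := fun n x t ↦ isGood_mapDomain x (coords_ne_zero t)
  have hwn : ∀ n x, IsNice (w n x) := fun n x ↦ isNice_coords.mapDomain x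
  let W (n : ℕ) (x : Fin (n + 1) →o P) (q : stdSimplex ℝ (Fin (n + 1)) × unitInterval) :
      P →₀ ℝ≥0 := unitInterval.toNNReal (unitInterval.symm q.2) • T (w n x q.1) +
        unitInterval.toNNReal q.2 • T' (w n x q.1)
  have hW : ∀ n x q, IsGood (W n x q) := fun n x q ↦
    isGood_combination (hT.good _ (hw n x q.1)).1 (hT'.good _ (hw n x q.1)).1
      (h _ (hw n x q.1)) (by ext; simp)
  have hWn : ∀ n x, IsNice (W n x) := fun n x ↦
    IsNice.combination
      ((hT.nice _ _ (hw n x) (hwn n x)).comp continuous_fst)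
      ((hT'.nice _ _ (hw n x) (hwn n x)).comp continuous_fst)
      (by fun_prop) (by fun_prop)
  obtain ⟨K, hK⟩ := exists_nerve_desc (P := P)
    (Z := C(unitInterval, SSet.toTop.obj (nerve P)))
    (fun n x ↦ ContinuousMap.curry
      ⟨fun q ↦ realize (W n x q), continuous_realize (hWn n x) (hW n x)⟩)
    (by
      intro m n g x t
      ext s
      have : w m (x.comp g) t = w n x (stdSimplex.map g t) := by
        simp only [w, coords_map]
        rw [← Finsupp.mapDomain_comp]
        rfl
      simp only [ContinuousMap.curry_apply, ContinuousMap.coe_mk, W, this])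
  let E (s : unitInterval) : C(SSet.toTop.obj (nerve P), SSet.toTop.obj (nerve P)) :=
    ⟨fun p ↦ K p s, (continuous_eval_const s).comp K.continuous⟩
  refine ⟨E 0, E 1, fun n x t ↦ ?_, fun n x t ↦ ?_, ⟨⟨⟨fun q ↦ K q.2 q.1, ?_⟩, ?_, ?_⟩⟩⟩
  · change K (seqMap x t) 0 = _
    rw [hK]
    simp [W, w]
  · change K (seqMap x t) 1 = _
    rw [hK]
    simp [W, w]
  · exact (ContinuousMap.continuous_uncurry_of_continuous K).comp continuous_swap
  · exact fun p ↦ rfl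
  · exact fun p ↦ rfl

end Operations

section Subdivision

/-- The poset of nonempty finite chains in a poset, ordered by inclusion. -/
abbrev Chains (Q : Type) [PartialOrder Q] : Type :=
  {c : Finset Q // c.Nonempty ∧ IsChain (· ≤ ·) (c : Set Q)}

variable {Q : Type} [PartialOrder Q]

lemma finite_chains_subset (S : Finset Q) : {c : Chains Q | c.1 ⊆ S}.Finite :=
  (S.powerset.finite_toSet.preimage Subtype.val_injective.injOn).subset
    fun _ hc ↦ Finset.mem_coe.2 (Finset.mem_powerset.2 hc)

open scoped Classical in
/-- The weight of a chain in the barycentric subdivision. -/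
noncomputable def subdivWeight (w : Q →₀ ℝ≥0) (c : Chains Q) : ℝ≥0 :=
  c.1.inf' c.2.1 w - (w.support \ c.1).sup w

lemma subset_support_of_subdivWeight_ne_zero {w : Q →₀ ℝ≥0} {c : Chains Q}
    (h : subdivWeight w c ≠ 0) : c.1 ⊆ w.support := by
  intro q hq
  rw [Finsupp.mem_support_iff]
  intro h0
  refine h (tsub_eq_zero_of_le ?_)
  exact (Finset.inf'_le w hq).trans (h0.le.trans zero_le)

/-- The weights on chains describing a point in the barycentric subdivision. -/
noncomputable def subdiv (w : Q →₀ ℝ≥0) : Chains Q →₀ ℝ≥0 :=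
  Finsupp.ofSupportFinite (subdivWeight w) <| (finite_chains_subset w.support).subset
    fun _ hc ↦ subset_support_of_subdivWeight_ne_zero hc

lemma subset_support_of_mem_support_subdiv {w : Q →₀ ℝ≥0} {c : Chains Q}
    (h : c ∈ (subdiv w).support) : c.1 ⊆ w.support :=
  subset_support_of_subdivWeight_ne_zero (Finsupp.mem_support_iff.1 h)

lemma lt_of_mem_support_subdiv {w : Q →₀ ℝ≥0} {c : Chains Q} (h : c ∈ (subdiv w).support)
    {a b : Q} (ha : a ∈ c.1) (hb : b ∈ w.support) (hb' : b ∉ c.1) : w b < w a := by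
  classical
  have h1 : subdivWeight w c ≠ 0 := Finsupp.mem_support_iff.1 h
  have h2 := tsub_pos_iff_lt.1 (pos_iff_ne_zero.2 h1)
  exact ((Finset.le_sup (f := w) (Finset.mem_sdiff.2 ⟨hb, hb'⟩)).trans_lt h2).trans_le
    (Finset.inf'_le w ha)

lemma isGood_subdiv {w : Q →₀ ℝ≥0} (hw : IsGood w) : IsGood (subdiv w) := by
  classical
  constructor
  · let c : Chains Q := ⟨w.support, Finsupp.support_nonempty_iff.2 hw.1, hw.2⟩
    refine DFunLike.ne_iff.2 ⟨c, ?_⟩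
    change subdivWeight w c ≠ 0
    have : subdivWeight w c = w.support.inf' c.2.1 w := by simp [subdivWeight, c]
    rw [this]
    obtain ⟨q, hq, h⟩ := Finset.exists_mem_eq_inf' c.2.1 w
    rw [h]
    exact Finsupp.mem_support_iff.1 hq
  · intro c hc c' hc' _
    by_contra! h
    obtain ⟨a, ha, ha'⟩ := Finset.not_subset.1 h.1
    obtain ⟨b, hb, hb'⟩ := Finset.not_subset.1 h.2
    exact lt_asymm
      (lt_of_mem_support_subdiv hc ha (subset_support_of_mem_support_subdiv hc' hb) hb')
      (lt_of_mem_support_subdiv hc' hb (subset_support_of_mem_support_subdiv hc ha) ha')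

lemma IsNice.subdiv {Y : Type*} [TopologicalSpace Y] {w : Y → Q →₀ ℝ≥0} (hw : IsNice w) :
    IsNice fun y ↦ subdiv (w y) := by
  classical
  obtain ⟨⟨S, hS⟩, hc⟩ := hw
  refine ⟨⟨(finite_chains_subset S).toFinset, fun y c h ↦ ?_⟩, fun c ↦ ?_⟩
  · simpa using (subset_support_of_mem_support_subdiv h).trans (hS y)
  · have h1 : Continuous fun y ↦ c.1.inf' c.2.1 (w y) - (S \ c.1).sup (w y) :=
      (Continuous.finset_inf'_apply c.2.1 fun q _ ↦ hc q).sub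
        (Continuous.finset_sup_apply fun q _ ↦ hc q)
    refine h1.congr fun y ↦ ?_
    change _ = (c.1.inf' c.2.1 (w y) - ((w y).support \ c.1).sup (w y) : ℝ≥0)
    congr 1
    refine le_antisymm (Finset.sup_le fun q hq ↦ ?_)
      (Finset.sup_mono (Finset.sdiff_subset_sdiff (hS y) subset_rfl))
    by_cases h : q ∈ (w y).support
    · exact Finset.le_sup (f := w y) (Finset.mem_sdiff.2 ⟨h, (Finset.mem_sdiff.1 hq).2⟩)
    · simp [Finsupp.notMem_support_iff.1 h]

lemma isOp_subdiv : IsOp (subdiv (Q := Q)) where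
  good _ hw := isGood_subdiv hw
  nice _ _ _ _ hw := hw.subdiv

lemma Chains.exists_isLeast (c : Chains Q) : ∃ q, IsLeast (c.1 : Set Q) q := by
  obtain ⟨q, hq⟩ := c.1.exists_minimal c.2.1
  exact ⟨q, hq.1, fun p hp ↦ (c.2.2.total hq.1 hp).elim id fun h ↦ hq.2 hp h⟩

lemma Chains.exists_isGreatest (c : Chains Q) : ∃ q, IsGreatest (c.1 : Set Q) q := by
  obtain ⟨q, hq⟩ := c.1.exists_maximal c.2.1
  exact ⟨q, hq.1, fun p hp ↦ (c.2.2.total hq.1 hp).elim (fun h ↦ hq.2 hp h) id⟩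

/-- The least element of a chain. -/
noncomputable def Chains.bot (c : Chains Q) : Q := c.exists_isLeast.choose

/-- The greatest element of a chain. -/
noncomputable def Chains.top (c : Chains Q) : Q := c.exists_isGreatest.choose

lemma Chains.bot_mem (c : Chains Q) : c.bot ∈ c.1 := c.exists_isLeast.choose_spec.1

lemma Chains.top_mem (c : Chains Q) : c.top ∈ c.1 := c.exists_isGreatest.choose_spec.1

lemma Chains.bot_le (c : Chains Q) {q : Q} (h : q ∈ c.1) : c.bot ≤ q :=
  c.exists_isLeast.choose_spec.2 h

lemma Chains.le_top (c : Chains Q) {q : Q} (h : q ∈ c.1) : q ≤ c.top :=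
  c.exists_isGreatest.choose_spec.2 h

lemma Chains.bot_antitone : Antitone (Chains.bot (Q := Q)) := fun _ c' h ↦
  c'.bot_le (h (Chains.bot_mem _))

lemma Chains.top_mono : Monotone (Chains.top (Q := Q)) := fun _ c' h ↦
  c'.le_top (h (Chains.top_mem _))

lemma Chains.bot_le_top {c c' : Chains Q} (h : c ≤ c' ∨ c' ≤ c) : c.bot ≤ c'.top :=
  h.elim (fun h ↦ c'.le_top (h c.bot_mem)) fun h ↦ c.bot_le (h c'.top_mem)

end Subdivision

section Cone

open CategoryTheory

variable {P : Type} [PartialOrder P]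

lemma isOp_mapDomain {Q Q' : Type} [PartialOrder Q] [PartialOrder Q'] {α : Q → Q'}
    (hα : Monotone α ∨ Antitone α) : IsOp (Finsupp.mapDomain (M := ℝ≥0) α) where
  good w hw := by
    classical
    refine ⟨mapDomain_ne_zero α hw.1, ?_⟩
    rw [support_mapDomain_eq, Finset.coe_image]
    rintro _ ⟨p, hp, rfl⟩ _ ⟨q, hq, rfl⟩ -
    exact hα.elim (fun hα ↦ (hw.2.total hp hq).imp (fun h ↦ hα h) fun h ↦ hα h)
      fun hα ↦ (hw.2.total hp hq).symm.imp (fun h ↦ hα h) fun h ↦ hα h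
  nice _ _ _ _ hw := hw.mapDomain α

/-- Two operations on weights realize homotopic self-maps. -/
def OpHomotopic [Nonempty P] (T T' : (P →₀ ℝ≥0) → (P →₀ ℝ≥0)) : Prop :=
  ∃ F F' : C(SSet.toTop.obj (nerve P), SSet.toTop.obj (nerve P)),
    Realizes F T ∧ Realizes F' T' ∧ F.Homotopic F'

lemma OpHomotopic.symm [Nonempty P] {T T' : (P →₀ ℝ≥0) → (P →₀ ℝ≥0)}
    (h : OpHomotopic T T') : OpHomotopic T' T := by
  obtain ⟨F, F', hF, hF', h⟩ := h
  exact ⟨F', F, hF', hF, h.symm⟩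

lemma OpHomotopic.trans [Nonempty P] {T T' T'' : (P →₀ ℝ≥0) → (P →₀ ℝ≥0)}
    (h : OpHomotopic T T') (h' : OpHomotopic T' T'') : OpHomotopic T T'' := by
  obtain ⟨F, F₁, hF, hF₁, h⟩ := h
  obtain ⟨F₂, F', hF₂, hF', h'⟩ := h'
  obtain rfl := hF₁.unique hF₂
  exact ⟨F, F', hF, hF', h.trans h'⟩

lemma opHomotopic_mapDomain [Nonempty P] {E : Type} [PartialOrder E]
    {T : (P →₀ ℝ≥0) → (E →₀ ℝ≥0)} (hT : IsOp T) {α β : E → P}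
    (hα : Monotone α ∨ Antitone α) (hβ : Monotone β ∨ Antitone β)
    (h : ∀ e e', e ≤ e' ∨ e' ≤ e → β e ≤ α e') :
    OpHomotopic (fun w ↦ Finsupp.mapDomain α (T w)) (fun w ↦ Finsupp.mapDomain β (T w)) := by
  classical
  refine exists_realizes_homotopic ((isOp_mapDomain hα).comp hT) ((isOp_mapDomain hβ).comp hT)
    fun w hw ↦ ?_
  have h1 := ((isOp_mapDomain hα).good _ (hT.good w hw)).2
  have h2 := ((isOp_mapDomain hβ).good _ (hT.good w hw)).2
  have hc := (hT.good w hw).2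
  have h3 : ∀ p ∈ (Finsupp.mapDomain α (T w)).support,
      ∀ q ∈ (Finsupp.mapDomain β (T w)).support, q ≤ p := by
    simp only [support_mapDomain_eq, Finset.mem_image]
    rintro _ ⟨e, he, rfl⟩ _ ⟨e', he', rfl⟩
    exact h e' e (hc.total he' he)
  rintro p (hp | hp) q (hq | hq) hne
  · exact h1 hp hq hne
  · exact Or.inr (h3 p hp q hq)
  · exact Or.inl (h3 q hq p hp)
  · exact h2 hp hq hne

/-- A poset is contractible if the identity is connected to a constant map by a zigzag of
comparable antitone maps defined on the second barycentric subdivision. -/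
theorem contractibleSpace_nerve (b : P) {f l m : Chains (Chains P) → P} (hf : Antitone f)
    (hl : Antitone l) (hm : Antitone m) (h1 : ∀ δ, f δ ≤ δ.bot.top) (h2 : ∀ δ, f δ ≤ l δ)
    (h3 : ∀ δ, m δ ≤ l δ) (h4 : ∀ δ, m δ ≤ b) :
    ContractibleSpace (SSet.toTop.obj (nerve P)) := by
  classical
  have : Nonempty P := ⟨b⟩
  let T : (P →₀ ℝ≥0) → (Chains (Chains (Chains P)) →₀ ℝ≥0) :=
    fun w ↦ subdiv (subdiv (subdiv w))
  have hT : IsOp T := isOp_subdiv.comp (isOp_subdiv.comp isOp_subdiv)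
  have hφ : Antitone fun δ : Chains (Chains P) ↦ δ.bot.top :=
    Chains.top_mono.comp_antitone Chains.bot_antitone
  have e0 : OpHomotopic (fun w : P →₀ ℝ≥0 ↦ w)
      (fun w ↦ Finsupp.mapDomain (fun ε ↦ ε.bot.bot.top) (T w)) := by
    have hα := isOp_mapDomain (α := fun ε : Chains (Chains (Chains P)) ↦ ε.bot.bot.top)
      (Or.inl (hφ.comp Chains.bot_antitone))
    refine exists_realizes_homotopic IsOp.id (hα.comp hT) fun w hw ↦ ?_
    refine hw.2.mono (Set.union_subset subset_rfl ?_)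
    rw [support_mapDomain_eq, Finset.coe_image]
    rintro _ ⟨ε, hε, rfl⟩
    exact subset_support_of_mem_support_subdiv (subset_support_of_mem_support_subdiv
      (subset_support_of_mem_support_subdiv hε ε.bot_mem) ε.bot.bot_mem) ε.bot.bot.top_mem
  have e1 := opHomotopic_mapDomain hT (α := fun ε ↦ ε.bot.bot.top) (β := fun ε ↦ f ε.top)
    (Or.inl (hφ.comp Chains.bot_antitone)) (Or.inr (hf.comp_monotone Chains.top_mono))
    fun e e' h ↦ (hf (Chains.bot_le_top h.symm)).trans (h1 _)
  have e2 := opHomotopic_mapDomain hT (α := fun ε ↦ l ε.bot) (β := fun ε ↦ f ε.top)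
    (Or.inl (hl.comp Chains.bot_antitone)) (Or.inr (hf.comp_monotone Chains.top_mono))
    fun e e' h ↦ (hf (Chains.bot_le_top h.symm)).trans (h2 _)
  have e3 := opHomotopic_mapDomain hT (α := fun ε ↦ l ε.bot) (β := fun ε ↦ m ε.top)
    (Or.inl (hl.comp Chains.bot_antitone)) (Or.inr (hm.comp_monotone Chains.top_mono))
    fun e e' h ↦ (hm (Chains.bot_le_top h.symm)).trans (h3 _)
  have e4 := opHomotopic_mapDomain hT (α := fun _ ↦ b) (β := fun ε ↦ m ε.top)
    (Or.inl monotone_const) (Or.inr (hm.comp_monotone Chains.top_mono)) fun e _ _ ↦ h4 _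
  obtain ⟨F, F', hF, hF', h⟩ := ((e0.trans e1).trans e2.symm).trans (e3.trans e4.symm)
  obtain rfl := hF.unique realizes_id
  rw [contractible_iff_id_nullhomotopic]
  let y : Fin (0 + 1) →o P := OrderHom.const _ b
  have hF'' : Realizes (ContinuousMap.const _ (seqMap y (Classical.arbitrary _)))
      fun w ↦ Finsupp.mapDomain (fun _ ↦ b) (T w) := by
    intro n x t
    have h0 := (hT.good _ (isGood_mapDomain x (coords_ne_zero t))).1
    have : Finsupp.mapDomain (fun _ ↦ b) (T (Finsupp.mapDomain x (coords t))) =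
        Finsupp.mapDomain y (Finsupp.mapDomain (fun _ ↦ 0) (T (Finsupp.mapDomain x (coords t)))) :=
      Finsupp.mapDomain_comp (f := fun _ ↦ (0 : Fin (0 + 1))) (g := y)
    simp only [this]
    rw [realize_mapDomain y (mapDomain_ne_zero _ h0)]
    exact congrArg (seqMap y) (Subsingleton.elim _ _)
  exact ⟨_, hF'.unique hF'' ▸ h⟩

end Cone

section Complements

variable {G : Type} [Group G] {F : Set (Subgroup G)}

/-- A choice of subgroups indexed by finite sets such that each of them complements the
intersection of the subgroups of the elements and of all the smaller subsets. -/
lemma exists_complements {P : Type} (H : P → Subgroup G) (hH : ∀ x, H x ∈ F)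
    (H₀ : Subgroup G) (hH₀ : H₀ ∈ F)
    (hcompl : ∀ s : Finset (Subgroup G), ↑s ⊆ F → s.Nonempty →
      ∃ K ∈ F, K ≠ ⊤ ∧ ((s.inf id : Subgroup G) : Set G) * (K : Set G) = Set.univ) :
    ∃ K : Finset P → Subgroup G, (∀ c, K c ∈ F) ∧ ∀ c (S : Finset (Finset P)),
      (∀ d ∈ S, d ⊂ c) → ∀ x ∈ c,
        ∀ g, ∃ a ∈ H x ⊓ S.inf K, ∃ k ∈ K c, g = a * k := by
  classical
  choose! κ hκF _ hκ using hcompl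
  let fam (c : Finset P) (rec : ∀ d, d ⊂ c → Subgroup G) : Finset (Subgroup G) :=
    insert H₀ (c.image H ∪ c.ssubsets.attach.image fun d ↦ rec d.1 (Finset.mem_ssubsets.1 d.2))
  let K : Finset P → Subgroup G := Finset.strongInduction fun c rec ↦ κ (fam c rec)
  have hK : ∀ c, K c = κ (fam c fun d _ ↦ K d) := fun c ↦ Finset.strongInduction_eq _ _
  have hn : ∀ c, (fam c fun d _ ↦ K d).Nonempty := fun c ↦ Finset.insert_nonempty _ _
  have hfam : ∀ c, (∀ d, d ⊂ c → K d ∈ F) → (↑(fam c fun d _ ↦ K d) : Set (Subgroup G)) ⊆ F := by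
    intro c hc U hU
    simp only [fam, Finset.coe_insert, Set.mem_insert_iff, Finset.mem_coe, Finset.mem_union,
      Finset.mem_image] at hU
    obtain rfl | ⟨x, -, rfl⟩ | ⟨d, -, rfl⟩ := hU
    · exact hH₀
    · exact hH x
    · exact hc _ (Finset.mem_ssubsets.1 d.2)
  have hKF : ∀ c, K c ∈ F := fun c ↦ by
    induction c using Finset.strongInduction with
    | H c ih =>
      rw [hK]
      exact hκF _ (hfam c ih) (hn c)
  refine ⟨K, hKF, fun c S hS x hx g ↦ ?_⟩
  have h := hκ _ (hfam c fun d _ ↦ hKF d) (hn c)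
  rw [← hK] at h
  obtain ⟨a, ha, k, hk, rfl⟩ := Set.mem_mul.1 (h.ge (Set.mem_univ g))
  refine ⟨a, ?_, k, hk, rfl⟩
  refine (le_inf (Finset.inf_le (f := id) ?_) (Finset.le_inf fun d hd ↦
    Finset.inf_le (f := id) ?_) : (fam c fun d _ ↦ K d).inf id ≤ H x ⊓ S.inf K) ha
  · exact Finset.mem_insert_of_mem (Finset.mem_union_left _ (Finset.mem_image_of_mem _ hx))
  · exact Finset.mem_insert_of_mem (Finset.mem_union_right _
      (Finset.mem_image.2 ⟨⟨d, Finset.mem_ssubsets.2 (hS d hd)⟩, Finset.mem_attach _ _, rfl⟩))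

/-- Every coset of the subgroup of a common element meets the intersection of the complements
along a chain of finite sets. -/
lemma exists_mem_smul_inter {P : Type} {H : P → Subgroup G} {K : Finset P → Subgroup G}
    (hK : ∀ c (S : Finset (Finset P)), (∀ d ∈ S, d ⊂ c) → ∀ x ∈ c,
      ∀ g, ∃ a ∈ H x ⊓ S.inf K, ∃ k ∈ K c, g = a * k)
    (x : P) (g : G) (S : Finset (Finset P)) (hS : IsChain (· ≤ ·) (S : Set (Finset P)))
    (hx : ∀ c ∈ S, x ∈ c) : ∃ l ∈ S.inf K, g⁻¹ * l ∈ H x := by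
  classical
  revert hS hx
  refine Finset.induction_on_max_value Finset.card S (fun _ _ ↦ ⟨g, by simp, by simp⟩) ?_
  · intro c S hc hmax ih hS hx
    obtain ⟨l, hl, hl'⟩ := ih (hS.mono (by simp)) fun d hd ↦ hx d (Finset.mem_insert_of_mem hd)
    have hS' : ∀ d ∈ S, d ⊂ c := by
      intro d hd
      have hne : d ≠ c := fun h ↦ hc (h ▸ hd)
      have := (hS.total (Finset.mem_insert_of_mem hd) (Finset.mem_insert_self c S))
      refine lt_of_le_of_ne (this.elim id fun h ↦ ?_) hne
      exact (Finset.eq_of_subset_of_card_le h (hmax d hd)).ge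
    obtain ⟨a, ha, k, hk, h⟩ := hK c S hS' x (hx c (Finset.mem_insert_self c S)) l⁻¹
    refine ⟨l * a, ?_, ?_⟩
    · rw [Finset.inf_insert, Subgroup.mem_inf]
      refine ⟨?_, mul_mem hl ha.2⟩
      have : l * a = k⁻¹ := by
        rw [eq_inv_iff_mul_eq_one, mul_assoc, ← h, mul_inv_cancel]
      exact this ▸ inv_mem hk
    · rw [← mul_assoc]
      exact mul_mem hl' ha.1

lemma inf_mem {ι : Type} {K : ι → Subgroup G} (hinter : ∀ H ∈ F, ∀ K ∈ F, H ⊓ K ∈ F)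
    {S : Finset ι} (hS : S.Nonempty) (hK : ∀ c ∈ S, K c ∈ F) : S.inf K ∈ F := by
  induction hS using Finset.Nonempty.cons_induction with
  | singleton a => simpa using hK a
  | cons a S ha _ ih =>
    rw [Finset.inf_cons]
    exact hinter _ (hK a (Finset.mem_cons_self a S)) _
      (ih fun c hc ↦ hK c (Finset.mem_cons_of_mem hc))

/-- A member of the family, viewed as an element of the coset poset. -/
def ofSubgroup (H : Subgroup G) (hH : H ∈ F) : CosetPoset G F :=
  ⟨H, H, hH, 1, (one_smul G _).symm⟩

end Complements

end CosetNerve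

/-- **Cone construction.** Let `F` be a nonempty family of subgroups of `G` closed
under pairwise intersections, such that any finitely many members of `F` have a
common complement in `F`. Then the geometric realization of the nerve of the coset
poset of `F` is contractible. -/
theorem statement19 {G : Type} [Group G] (F : Set (Subgroup G)) (hne : F.Nonempty)
    (hinter : ∀ H ∈ F, ∀ K ∈ F, H ⊓ K ∈ F)
    (hcompl : ∀ s : Finset (Subgroup G), ↑s ⊆ F → s.Nonempty →
      ∃ K ∈ F, K ≠ ⊤ ∧ ((s.inf id : Subgroup G) : Set G) * (K : Set G) = Set.univ) :
    ContractibleSpace (cosetNerveRealization G F) := by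
  classical
  obtain ⟨H₀, hH₀⟩ := hne
  choose H hH g hg using fun x : CosetPoset G F ↦ x.2
  obtain ⟨K, hKF, hK⟩ := CosetNerve.exists_complements H hH H₀ hH₀ hcompl
  let L (δ : CosetNerve.Chains (CosetNerve.Chains (CosetPoset G F))) : Subgroup G :=
    (δ.1.image Subtype.val).inf K
  have hLF : ∀ δ, L δ ∈ F := fun δ ↦
    CosetNerve.inf_mem hinter (δ.2.1.image _) fun c _ ↦ hKF c
  have hL : Antitone L := fun δ δ' h ↦ Finset.inf_mono (Finset.image_subset_image h)
  have hmeet : ∀ δ, ∃ l ∈ L δ, (g δ.bot.top)⁻¹ * l ∈ H δ.bot.top := fun δ ↦ by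
    refine CosetNerve.exists_mem_smul_inter hK _ _ _ ?_ ?_
    · rw [Finset.coe_image]
      rintro _ ⟨c, hc, rfl⟩ _ ⟨d, hd, rfl⟩ -
      exact δ.2.2.total hc hd
    · simp only [Finset.mem_image]
      rintro _ ⟨c, hc, rfl⟩
      exact δ.bot_le hc δ.bot.top_mem
  have hf : ∀ δ, ∃ U ∈ F, ∃ a : G, (δ.bot.top.1 ∩ L δ : Set G) = a • (U : Set G) := fun δ ↦ by
    obtain ⟨l, hl, hl'⟩ := hmeet δ
    refine ⟨H δ.bot.top ⊓ L δ, hinter _ (hH _) _ (hLF δ), l, ?_⟩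
    rw [hg δ.bot.top, Subgroup.coe_inf, Set.smul_set_inter]
    congr 1
    · rw [leftCoset_eq_iff]
      exact hl'
    · exact (leftCoset_mem_leftCoset (L δ) hl).symm
  refine CosetNerve.contractibleSpace_nerve (CosetNerve.ofSubgroup H₀ hH₀)
    (f := fun δ ↦ ⟨_, hf δ⟩) (l := fun δ ↦ CosetNerve.ofSubgroup (L δ) (hLF δ))
    (m := fun δ ↦ CosetNerve.ofSubgroup (L δ ⊓ H₀) (hinter _ (hLF δ) _ hH₀)) ?_ ?_ ?_ ?_ ?_ ?_ ?_
  · intro δ δ' h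
    exact Set.inter_subset_inter (CosetNerve.Chains.top_mono (CosetNerve.Chains.bot_antitone h))
      (hL h)
  · exact fun δ δ' h ↦ hL h
  · exact fun δ δ' h ↦ inf_le_inf_right H₀ (hL h)
  · exact fun δ ↦ Set.inter_subset_left
  · exact fun δ ↦ Set.inter_subset_right
  · exact fun δ ↦ (inf_le_left : L δ ⊓ H₀ ≤ L δ)
  · exact fun δ ↦ (inf_le_right : L δ ⊓ H₀ ≤ H₀)
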